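/- arXiv:2011.05931 — 3 statements merged into one kernel-verified Lean document; each statement's English description precedes it below -/
import Mathlib

section
/- Consider a discrete Poisson channel with memory of order K ≥ 1, channel coefficients π ∈ [0,∞)^K and dark noise d > 0. Let the blocklength N satisfy N ≥ K+1 and let P ≥ 0. Define codewords x1*, x2* ∈ [0,∞)^N by x1*_0 = P and x1*_i = 0 for i ≠ 0, and x2*_K = P and x2*_i = 0 for i ≠ K. Then for every pair of codewords x1, x2 ∈ [0,∞)^N with ∑_{i=0}^{N−1} x1_i ≤ P and ∑_{i=0}^{N−1} x2_i ≤ P, one has P_e(x1* * π, x2* * π) ≤ P_e(x1 * π, x2 * π); that is, the pair (x1*, x2*) minimizes the maximum-likelihood error probability among all codeword pairs satisfying the total-power constraint P. -/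
open scoped BigOperators

/-- Poisson probability mass at `k` for mean `a`. -/
noncomputable def poissonPdf (a : ℝ) (k : ℕ) : ℝ :=
  Real.exp (-a) * a ^ k / (Nat.factorial k : ℝ)

/-- Joint pmf of independent Poisson coordinates with mean vector `m`. -/
noncomputable def prodPdf {n : ℕ} (m : Fin n → ℝ) (y : Fin n → ℕ) : ℝ :=
  ∏ i, poissonPdf (m i) (y i)

/-- Average error probability of a decoder `g` for the binary hypothesis test between
independent Poisson observations with mean vectors `lam + d` (hypothesis 1) and
`mu + d` (hypothesis 2); `g y = true` means "decide hypothesis 1". -/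
noncomputable def errProb {n : ℕ} (d : ℝ) (lam mu : Fin n → ℝ)
    (g : (Fin n → ℕ) → Bool) : ℝ :=
  (1/2) * (∑' y : Fin n → ℕ, if g y = false then prodPdf (fun i => lam i + d) y else 0)
  + (1/2) * (∑' y : Fin n → ℕ, if g y = true then prodPdf (fun i => mu i + d) y else 0)

/-- Minimal (maximum-likelihood) average error probability. -/
noncomputable def Pe {n : ℕ} (d : ℝ) (lam mu : Fin n → ℝ) : ℝ :=
  ⨅ g : (Fin n → ℕ) → Bool, errProb d lam mu g

/-- Convolution of a codeword `x` of length `N` with channel coefficients `p` of length `K`,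
giving the mean vector of length `N + K - 1`. -/
noncomputable def cconv {N K : ℕ} (x : Fin N → ℝ) (p : Fin K → ℝ) :
    Fin (N + K - 1) → ℝ :=
  fun i => ∑ j : Fin K,
    p j * (if h : (j : ℕ) ≤ (i : ℕ) ∧ (i : ℕ) - (j : ℕ) < N
      then x ⟨(i : ℕ) - (j : ℕ), h.2⟩ else 0)

/-- Sum of the `k` largest entries of `v`. -/
noncomputable def topSum {m : ℕ} (v : Fin m → ℝ) (k : ℕ) : ℝ :=
  ⨆ s ∈ {s : Finset (Fin m) | s.card = k}, ∑ i ∈ s, v i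

/-- Weak submajorization (from below): every top-`k` sum of `u` is at most that of `v`. -/
def weakSubmaj {m : ℕ} (u v : Fin m → ℝ) : Prop :=
  ∀ k, 1 ≤ k → k ≤ m → topSum u k ≤ topSum v k

open MeasureTheory ProbabilityTheory
open scoped NNReal

lemma hasSum_indicator_measureReal_singleton {Ω : Type*} [Countable Ω] [MeasurableSpace Ω]
    [DiscreteMeasurableSpace Ω] (μ : Measure Ω) [IsFiniteMeasure μ] (s : Set Ω) :
    HasSum (s.indicator fun ω => μ.real {ω}) (μ.real s) := by
  have h := μ.tsum_indicator_apply_singleton s .of_discrete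
  have hne : ∑' ω, s.indicator (fun ω => μ {ω}) ω ≠ ⊤ := h ▸ measure_ne_top μ s
  have := ENNReal.hasSum_toReal hne
  rw [measureReal_def, ← h, ENNReal.tsum_toReal_eq (ENNReal.ne_top_of_tsum_ne_top hne)]
  convert this using 1
  funext ω
  by_cases hω : ω ∈ s <;> simp [hω, measureReal_def]

/-- Observing a statistic `Z` which is sufficient for two hypotheses is as good as observing the
whole sample. -/
lemma exists_decoder_of_sufficient {Ω E : Type*} [Countable Ω] [MeasurableSpace Ω]
    [DiscreteMeasurableSpace Ω] [MeasurableSpace E] [DiscreteMeasurableSpace E]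
    {P₁ P₂ : Measure Ω} {Q₁ Q₂ : Measure E} [IsFiniteMeasure P₁] [IsFiniteMeasure P₂]
    {Z : Ω → E} (hZ₁ : HasLaw Z Q₁ P₁) (hZ₂ : HasLaw Z Q₂ P₂) {h : Ω → ℝ} (h_nonneg : ∀ ω, 0 ≤ h ω)
    (h₁ : ∀ ω, P₁.real {ω} = h ω * Q₁.real {Z ω}) (h₂ : ∀ ω, P₂.real {ω} = h ω * Q₂.real {Z ω})
    (g : Ω → Bool) :
    ∃ g' : E → Bool, Q₁.real {e | g' e = false} + Q₂.real {e | g' e = true} ≤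
      P₁.real {ω | g ω = false} + P₂.real {ω | g ω = true} := by
  classical
  refine ⟨fun e => decide (Q₂.real {e} ≤ Q₁.real {e}), ?_⟩
  rw [← hZ₁.measureReal_eq .of_discrete, ← hZ₂.measureReal_eq .of_discrete]
  refine hasSum_le (fun ω => ?_)
    ((hasSum_indicator_measureReal_singleton P₁ _).add
      (hasSum_indicator_measureReal_singleton P₂ _))
    ((hasSum_indicator_measureReal_singleton P₁ _).add
      (hasSum_indicator_measureReal_singleton P₂ _))
  simp only [Set.indicator_apply, Set.mem_ofPred_eq, h₁, h₂]
  by_cases hQ : Q₂.real {Z ω} ≤ Q₁.real {Z ω}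
  · have := mul_le_mul_of_nonneg_left hQ (h_nonneg ω)
    by_cases hg : g ω = true <;> simp [hQ, hg, this]
  · have := mul_le_mul_of_nonneg_left (not_le.1 hQ).le (h_nonneg ω)
    by_cases hg : g ω = true <;> simp [hQ, hg, this]

lemma hasLaw_sum_poissonMeasure {Ω ι : Type*} [MeasurableSpace Ω] {P : Measure Ω}
    {X : ι → Ω → ℕ} {r : ι → ℝ≥0} (hX : ∀ i, HasLaw (X i) (poissonMeasure (r i)) P)
    (hXm : ∀ i, Measurable (X i)) (hind : iIndepFun X P) (s : Finset ι) :
    HasLaw (∑ i ∈ s, X i) (poissonMeasure (∑ i ∈ s, r i)) P := by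
  classical
  have := hind.isProbabilityMeasure
  induction s using Finset.induction_on with
  | empty =>
    have h0 : poissonMeasure 0 = Measure.dirac 0 := by
      refine Measure.ext_of_singleton fun k => ?_
      rw [poissonMeasure_singleton]
      rcases eq_or_ne k 0 with rfl | hk
      · simp
      · simp [hk, hk.symm]
    simp only [Finset.sum_empty, h0]
    exact ⟨aemeasurable_const, (Measure.map_const P 0).trans (by simp)⟩
  | insert i s hi ih =>
    rw [Finset.sum_insert hi, Finset.sum_insert hi, add_comm, add_comm (r i)]
    exact (hind.indepFun_finsetSum_of_notMem hXm hi).hasLaw_add_poissonMeasure ih (hX i)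

/-- The law of an array of independent Poisson variables with means `r s t`. -/
noncomputable def poissonArray {ι κ : Type*} [Fintype ι] [Fintype κ] (r : ι → κ → ℝ≥0) :
    Measure (ι → κ → ℕ) :=
  Measure.pi fun s => Measure.pi fun t => poissonMeasure (r s t)

instance {ι κ : Type*} [Fintype ι] [Fintype κ] (r : ι → κ → ℝ≥0) :
    IsProbabilityMeasure (poissonArray r) := by
  unfold poissonArray; infer_instance

lemma pi_real_singleton {ι : Type*} [Fintype ι] {α : ι → Type*} [∀ i, MeasurableSpace (α i)]
    (μ : ∀ i, Measure (α i)) [∀ i, SigmaFinite (μ i)] (x : ∀ i, α i) :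
    (Measure.pi μ).real {x} = ∏ i, (μ i).real {x i} := by
  simp only [measureReal_def, Measure.pi_singleton, ENNReal.toReal_prod]

lemma poissonArray_real_singleton {ι κ : Type*} [Fintype ι] [Fintype κ] (r : ι → κ → ℝ≥0)
    (N : ι → κ → ℕ) :
    (poissonArray r).real {N} = ∏ s, ∏ t, poissonPdf (r s t) (N s t) := by
  simp only [poissonArray, pi_real_singleton, poissonMeasure_real_singleton, poissonPdf]

lemma hasLaw_row_sums_poissonArray {ι ι' κ : Type*} [Fintype ι] [Fintype ι'] [Fintype κ]
    (r : ι → κ → ℝ≥0) {e : ι' → ι} (he : e.Injective) :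
    HasLaw (fun N i => ∑ t, N (e i) t) (Measure.pi fun i => poissonMeasure (∑ t, r (e i) t))
      (poissonArray r) := by
  have hind : iIndepFun (fun s (N : ι → κ → ℕ) => ∑ t, N s t) (poissonArray r) :=
    iIndepFun_pi (X := fun _ (y : κ → ℕ) => ∑ t, y t) fun _ => Measurable.of_discrete.aemeasurable
  refine (hind.precomp he).hasLaw_pi fun i => ?_
  have hrow : HasLaw (∑ t, fun y : κ → ℕ => y t) (poissonMeasure (∑ t, r (e i) t))
      (Measure.pi fun t => poissonMeasure (r (e i) t)) :=
    hasLaw_sum_poissonMeasure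
      (fun t => (measurePreserving_eval (fun t => poissonMeasure (r (e i) t)) t).hasLaw)
      (fun t => measurable_pi_apply t)
      (iIndepFun_pi (X := fun _ => id) fun _ => aemeasurable_id) _
  have := hrow.comp (measurePreserving_eval
    (fun s => Measure.pi fun t => poissonMeasure (r s t)) (e i)).hasLaw
  convert! this using 1
  ext N
  simp

lemma hasLaw_swap_poissonArray {ι κ : Type*} [Fintype ι] [Fintype κ] (r : ι → κ → ℝ≥0) :
    HasLaw (fun N t s => N s t) (poissonArray fun t s => r s t) (poissonArray r) where
  aemeasurable := Measurable.of_discrete.aemeasurable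
  map_eq := by
    refine Measure.ext_of_singleton fun N => ?_
    rw [Measure.map_apply .of_discrete .of_discrete]
    have : (fun (N : ι → κ → ℕ) t s => N s t) ⁻¹' {N} = {fun s t => N t s} := by
      ext M
      simp only [Set.mem_preimage, Set.mem_singleton_iff, funext_iff]
      exact forall_comm
    rw [this]
    simp only [poissonArray, Measure.pi_singleton]
    exact Finset.prod_comm

lemma prod_poissonPdf_mul {κ : Type*} [Fintype κ] (q : κ → ℝ) (m : ℝ) (y : κ → ℕ) :
    ∏ t, poissonPdf (q t * m) (y t) =
      (∏ t, q t ^ y t / (y t).factorial) * (Real.exp (-((∑ t, q t) * m)) * m ^ ∑ t, y t) := by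
  simp only [poissonPdf, mul_pow, Finset.sum_mul, ← Finset.sum_neg_distrib, Real.exp_sum,
    ← Finset.prod_pow_eq_pow_sum, ← Finset.prod_mul_distrib]
  exact Finset.prod_congr rfl fun t _ => by ring

lemma errProb_eq_measureReal {n : ℕ} {d : ℝ} {lam mu : Fin n → ℝ} (r₁ r₂ : Fin n → ℝ≥0)
    (h₁ : ∀ i, r₁ i = lam i + d) (h₂ : ∀ i, r₂ i = mu i + d) (g : (Fin n → ℕ) → Bool) :
    errProb d lam mu g = (1 / 2) *
      ((Measure.pi fun i => poissonMeasure (r₁ i)).real {y | g y = false} +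
        (Measure.pi fun i => poissonMeasure (r₂ i)).real {y | g y = true}) := by
  have key (m : Fin n → ℝ) (r : Fin n → ℝ≥0) (h : ∀ i, r i = m i + d) (b : Bool) :
      ∑' y, (if g y = b then prodPdf (fun i => m i + d) y else 0) =
        (Measure.pi fun i => poissonMeasure (r i)).real {y | g y = b} := by
    rw [← (hasSum_indicator_measureReal_singleton _ _).tsum_eq]
    refine tsum_congr fun y => ?_
    simp only [Set.indicator_apply, Set.mem_ofPred_eq, prodPdf, poissonPdf, pi_real_singleton,
      poissonMeasure_real_singleton, ← h]
  rw [errProb, key lam r₁ h₁, key mu r₂ h₂, mul_add]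

/-- Thinning the coordinates of a Poisson vector, routing the retained points to new coordinates
and adding independent Poisson noise cannot improve the best decoder. Here `q (some j) t` is the
probability that a point of coordinate `j` is routed to `t` (lost if `t = none`), and
`q none (some i)` is the mean of the noise added to coordinate `i`. -/
lemma exists_decoder_of_thinning {n n' : ℕ} {r₁ r₂ : Fin n → ℝ≥0} {r₁' r₂' : Fin n' → ℝ≥0}
    (q : Option (Fin n) → Option (Fin n') → ℝ≥0) (hq : ∀ j, ∑ t, q (some j) t = 1)
    (h₁ : ∀ i, r₁' i = q none (some i) + ∑ j, q (some j) (some i) * r₁ j)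
    (h₂ : ∀ i, r₂' i = q none (some i) + ∑ j, q (some j) (some i) * r₂ j)
    (g : (Fin n' → ℕ) → Bool) :
    ∃ g' : (Fin n → ℕ) → Bool,
      (Measure.pi fun i => poissonMeasure (r₁ i)).real {y | g' y = false} +
        (Measure.pi fun i => poissonMeasure (r₂ i)).real {y | g' y = true} ≤
      (Measure.pi fun i => poissonMeasure (r₁' i)).real {y | g y = false} +
        (Measure.pi fun i => poissonMeasure (r₂' i)).real {y | g y = true} := by
  let arr (r : Fin n → ℝ≥0) : Option (Fin n) → Option (Fin n') → ℝ≥0 := fun s t =>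
    q s t * s.elim 1 r
  let Z (N : Option (Fin n) → Option (Fin n') → ℕ) (j : Fin n) : ℕ := ∑ t, N (some j) t
  let Y (N : Option (Fin n) → Option (Fin n') → ℕ) (i : Fin n') : ℕ := ∑ s, N s (some i)
  have hZ (r : Fin n → ℝ≥0) :
      HasLaw Z (Measure.pi fun j => poissonMeasure (r j)) (poissonArray (arr r)) := by
    have := hasLaw_row_sums_poissonArray (arr r) (Option.some_injective _)
    simpa only [arr, Option.elim_some, ← Finset.sum_mul, hq, one_mul] using this
  have hY (r : Fin n → ℝ≥0) (r' : Fin n' → ℝ≥0)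
      (h : ∀ i, r' i = q none (some i) + ∑ j, q (some j) (some i) * r j) :
      HasLaw Y (Measure.pi fun i => poissonMeasure (r' i)) (poissonArray (arr r)) := by
    have := (hasLaw_row_sums_poissonArray (fun t s => arr r s t) (Option.some_injective _)).comp
      (hasLaw_swap_poissonArray (arr r))
    simp only [arr, Fintype.sum_option, Option.elim_some, Option.elim_none, mul_one, ← h] at this
    convert! this using 1
    funext N i
    simp [Y, Fintype.sum_option]
  have hfactor (r : Fin n → ℝ≥0) (N : Option (Fin n) → Option (Fin n') → ℕ) :
      (poissonArray (arr r)).real {N} =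
        ((∏ s, ∏ t, (q s t : ℝ) ^ N s t / (N s t).factorial) * Real.exp (-∑ t, (q none t : ℝ)) *
          ∏ j, ((Z N j).factorial : ℝ)) *
        (Measure.pi fun j => poissonMeasure (r j)).real {Z N} := by
    have hq' (j : Fin n) : ∑ t, (q (some j) t : ℝ) = 1 := by exact_mod_cast hq j
    simp only [poissonArray_real_singleton, arr, NNReal.coe_mul, prod_poissonPdf_mul,
      Finset.prod_mul_distrib, pi_real_singleton, poissonMeasure_real_singleton]
    simp only [Fintype.prod_option, Option.elim_some, Option.elim_none, NNReal.coe_one, one_pow,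
      mul_one, hq', one_mul, Finset.prod_div_distrib, Finset.prod_mul_distrib]
    have : (∏ j, ((Z N j).factorial : ℝ)) ≠ 0 := Finset.prod_ne_zero_iff.2 fun j _ => by positivity
    field_simp
    rfl
  obtain ⟨g', hg'⟩ := exists_decoder_of_sufficient (hZ r₁) (hZ r₂) (fun N => by positivity)
    (hfactor r₁) (hfactor r₂) (fun N => g (Y N))
  refine ⟨g', hg'.trans_eq ?_⟩
  rw [← (hY r₁ r₁' h₁).measureReal_eq .of_discrete, ← (hY r₂ r₂' h₂).measureReal_eq .of_discrete]

lemma errProb_nonneg {n : ℕ} {d : ℝ} {lam mu : Fin n → ℝ} (hlam : ∀ i, 0 ≤ lam i + d)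
    (hmu : ∀ i, 0 ≤ mu i + d) (g : (Fin n → ℕ) → Bool) : 0 ≤ errProb d lam mu g := by
  rw [errProb_eq_measureReal _ _ (fun i => Real.coe_toNNReal _ (hlam i))
    (fun i => Real.coe_toNNReal _ (hmu i))]
  positivity

/-- Data-processing inequality for Poisson channels: if both mean vectors are transformed by the
same nonnegative affine map whose linear part `D` is a thinning, the error probability can only
increase. -/
lemma Pe_le_Pe_of_thinning {n n' : ℕ} {d : ℝ} {lam mu : Fin n → ℝ} {lam' mu' : Fin n' → ℝ}
    (hlam : ∀ i, 0 ≤ lam i + d) (hmu : ∀ i, 0 ≤ mu i + d)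
    {D : Fin n → Fin n' → ℝ} {c : Fin n' → ℝ} (hD : ∀ j i, 0 ≤ D j i) (hc : ∀ i, 0 ≤ c i)
    (hD_sum : ∀ j, ∑ i, D j i ≤ 1)
    (hlam' : ∀ i, lam' i + d = c i + ∑ j, D j i * (lam j + d))
    (hmu' : ∀ i, mu' i + d = c i + ∑ j, D j i * (mu j + d)) :
    Pe d lam mu ≤ Pe d lam' mu' := by
  have hnonneg' (m : Fin n → ℝ) (m' : Fin n' → ℝ) (hm : ∀ i, 0 ≤ m i + d)
      (h : ∀ i, m' i + d = c i + ∑ j, D j i * (m j + d)) (i : Fin n') : 0 ≤ m' i + d :=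
    h i ▸ add_nonneg (hc i) (Finset.sum_nonneg fun j _ => mul_nonneg (hD j i) (hm j))
  let q : Option (Fin n) → Option (Fin n') → ℝ≥0
    | some j, some i => (D j i).toNNReal
    | some j, none => (1 - ∑ i, D j i).toNNReal
    | none, some i => (c i).toNNReal
    | none, none => 0
  refine le_ciInf fun g => ?_
  obtain ⟨g', hg'⟩ := exists_decoder_of_thinning (r₁ := fun i => (lam i + d).toNNReal)
    (r₂ := fun i => (mu i + d).toNNReal) (r₁' := fun i => (lam' i + d).toNNReal)
    (r₂' := fun i => (mu' i + d).toNNReal) q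
    (fun j => by
      rw [← NNReal.coe_inj]
      simp [q, Fintype.sum_option, Real.coe_toNNReal _ (sub_nonneg.2 (hD_sum j)), hD])
    (fun i => by
      rw [← NNReal.coe_inj, Real.coe_toNNReal _ (hnonneg' lam lam' hlam hlam' i), hlam']
      simp [q, hD, hc, hlam])
    (fun i => by
      rw [← NNReal.coe_inj, Real.coe_toNNReal _ (hnonneg' mu mu' hmu hmu' i), hmu']
      simp [q, hD, hc, hmu]) g
  refine (ciInf_le ⟨0, ?_⟩ g').trans ?_
  · rintro _ ⟨g, rfl⟩
    exact errProb_nonneg hlam hmu g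
  · rw [errProb_eq_measureReal _ _ (fun i => Real.coe_toNNReal _ (hlam i))
        (fun i => Real.coe_toNNReal _ (hmu i)),
      errProb_eq_measureReal _ _ (fun i => Real.coe_toNNReal _ (hnonneg' lam lam' hlam hlam' i))
        (fun i => Real.coe_toNNReal _ (hnonneg' mu mu' hmu hmu' i))]
    exact mul_le_mul_of_nonneg_left hg' (by norm_num)

/-- A version of `Pe_le_Pe_of_thinning` which only observes the coordinates in the range of `e`. -/
lemma Pe_le_Pe_of_thinning_of_injective {U : Type*} [Fintype U] {n n' : ℕ} {d : ℝ}
    {lam mu : Fin n → ℝ} {lam' mu' : Fin n' → ℝ} (hlam : ∀ i, 0 ≤ lam i + d)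
    (hmu : ∀ i, 0 ≤ mu i + d) {e : U → Fin n} (he : e.Injective) {C : U → Fin n' → ℝ}
    {c : Fin n' → ℝ} (hC : ∀ u i, 0 ≤ C u i) (hc : ∀ i, 0 ≤ c i) (hC_sum : ∀ u, ∑ i, C u i ≤ 1)
    (hlam' : ∀ i, lam' i + d = c i + ∑ u, C u i * (lam (e u) + d))
    (hmu' : ∀ i, mu' i + d = c i + ∑ u, C u i * (mu (e u) + d)) :
    Pe d lam mu ≤ Pe d lam' mu' := by
  classical
  have hsum (m : Fin n → ℝ) (i : Fin n') :
      ∑ j, (∑ u, if e u = j then C u i else 0) * (m j + d) = ∑ u, C u i * (m (e u) + d) := by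
    simp only [Finset.sum_mul]
    rw [Finset.sum_comm]
    simp
  refine Pe_le_Pe_of_thinning hlam hmu (D := fun j i => ∑ u, if e u = j then C u i else 0)
    (fun j i => Finset.sum_nonneg fun u _ => ?_) hc (fun j => ?_)
    (fun i => by rw [hsum, hlam']) (fun i => by rw [hsum, hmu'])
  · split_ifs
    exacts [hC u i, le_rfl]
  · by_cases hj : ∃ u, e u = j
    · obtain ⟨u, rfl⟩ := hj
      simpa [he.eq_iff] using hC_sum u
    · push Not at hj
      simp [hj]

/-- The codeword `x` delayed by `k` time steps, evaluated at time `i`. -/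
noncomputable def delayed {N : ℕ} (x : Fin N → ℝ) (k i : ℕ) : ℝ :=
  if h : k ≤ i ∧ i - k < N then x ⟨i - k, h.2⟩ else 0

lemma cconv_apply {N K : ℕ} (x : Fin N → ℝ) (p : Fin K → ℝ) (i : Fin (N + K - 1)) :
    cconv x p i = ∑ k : Fin K, p k * delayed x k i :=
  rfl

lemma delayed_nonneg {N : ℕ} {x : Fin N → ℝ} (hx : ∀ i, 0 ≤ x i) (k i : ℕ) :
    0 ≤ delayed x k i := by
  unfold delayed
  split_ifs
  exacts [hx _, le_rfl]

lemma delayed_eq_sum {N : ℕ} (x : Fin N → ℝ) (k i : ℕ) :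
    delayed x k i = ∑ m : Fin N, if i = m + k then x m else 0 := by
  unfold delayed
  split_ifs with h
  · rw [Finset.sum_eq_single ⟨i - k, h.2⟩]
    · rw [if_pos]
      simp only
      omega
    · intro m _ hm
      rw [if_neg]
      contrapose hm
      ext
      simp only
      omega
    · simp
  · refine (Finset.sum_eq_zero fun m _ => if_neg ?_).symm
    have := m.2
    omega

lemma sum_delayed_le {ι : Type*} [Fintype ι] {N : ℕ} {x : Fin N → ℝ} (hx : ∀ i, 0 ≤ x i)
    {k i : ι → ℕ} (hki : ∀ m a b, i a = m + k a → i b = m + k b → a = b) :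
    ∑ a, delayed x (k a) (i a) ≤ ∑ m, x m := by
  classical
  simp only [delayed_eq_sum]
  rw [Finset.sum_comm]
  refine Finset.sum_le_sum fun m _ => ?_
  by_cases h : ∃ a, i a = m + k a
  · obtain ⟨a, ha⟩ := h
    rw [Finset.sum_eq_single a]
    · rw [if_pos ha]
    · exact fun b _ hb => if_neg fun h => hb (hki m b a h ha)
    · simp
  · push Not at h
    simpa [h] using hx m

lemma cconv_nonneg {N K : ℕ} {x : Fin N → ℝ} {p : Fin K → ℝ} (hx : ∀ i, 0 ≤ x i)
    (hp : ∀ k, 0 ≤ p k) (i : Fin (N + K - 1)) : 0 ≤ cconv x p i :=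
  Finset.sum_nonneg fun k _ => mul_nonneg (hp k) (delayed_nonneg hx _ _)

lemma cconv_pulse {N K a : ℕ} (ha : a < N) {P : ℝ} {x : Fin N → ℝ}
    (hx : ∀ i : Fin N, x i = if (i : ℕ) = a then P else 0) (p : Fin K → ℝ)
    (i : Fin (N + K - 1)) :
    cconv x p i = ∑ k : Fin K, if (i : ℕ) = a + k then P * p k else 0 := by
  rw [cconv_apply]
  refine Finset.sum_congr rfl fun k _ => ?_
  rw [delayed_eq_sum, Finset.sum_eq_single ⟨a, ha⟩]
  · simp [hx, mul_comm]
  · intro m _ hm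
    have : (m : ℕ) ≠ a := fun h => hm (Fin.ext h)
    simp [hx, this]
  · simp

lemma excess_div_mul_self {a b : ℝ} (ha : 0 ≤ a) (hb : 0 ≤ b) :
    (a - min a b) / a * a = a - min a b := by
  rcases ha.eq_or_lt with rfl | h
  · simp [hb]
  · field_simp

lemma excess_div_add_excess_div_le_one {a b : ℝ} (ha : 0 ≤ a) (hb : 0 ≤ b) :
    (a - min a b) / a + (b - min a b) / b ≤ 1 := by
  rcases le_total a b with h | h
  · simpa [h] using div_le_one_of_le₀ (by linarith) hb
  · simpa [h] using div_le_one_of_le₀ (by linarith) ha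

/-- Under a total-power constraint `P`, for blocklength `N ≥ K + 1`, the pair
`x1* = (P,0,…,0)`, `x2* = (0,…,0,P,0,…,0)` (with `P` in position `K`) minimizes the
ML error probability of the Poisson channel with memory coefficients `p` and dark noise `d`. -/
theorem stmt0 (K : ℕ) (hK : 1 ≤ K) (p : Fin K → ℝ) (hp : ∀ j, 0 ≤ p j)
    (d : ℝ) (hd : 0 < d) (N : ℕ) (hN : K + 1 ≤ N) (P : ℝ) (hP : 0 ≤ P)
    (x1s x2s : Fin N → ℝ)
    (hx1s : ∀ i : Fin N, x1s i = if (i : ℕ) = 0 then P else 0)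
    (hx2s : ∀ i : Fin N, x2s i = if (i : ℕ) = K then P else 0) :
    ∀ x1 x2 : Fin N → ℝ, (∀ i, 0 ≤ x1 i) → (∀ i, 0 ≤ x2 i) →
      (∑ i, x1 i) ≤ P → (∑ i, x2 i) ≤ P →
      Pe d (cconv x1s p) (cconv x2s p) ≤ Pe d (cconv x1 p) (cconv x2 p) := by
  intro x1 x2 hx1 hx2 hs1 hs2
  rcases hP.eq_or_lt with rfl | hPpos
  · have hzero (x : Fin N → ℝ) (hx : ∀ i, 0 ≤ x i) (hs : ∑ i, x i ≤ 0) : x = 0 :=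
      funext fun i => (Finset.sum_eq_zero_iff_of_nonneg fun i _ => hx i).1
        (hs.antisymm (Finset.sum_nonneg fun i _ => hx i)) i (Finset.mem_univ i)
    have h1 : x1s = 0 := funext fun i => by simp [hx1s]
    have h2 : x2s = 0 := funext fun i => by simp [hx2s]
    rw [hzero x1 hx1 hs1, hzero x2 hx2 hs2, h1, h2]
  have hx1s' (i) : 0 ≤ x1s i := by
    rw [hx1s]; split_ifs <;> simp [hP]
  have hx2s' (i) : 0 ≤ x2s i := by
    rw [hx2s]; split_ifs <;> simp [hP]
  set lam := cconv x1 p with hlam_def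
  set mu := cconv x2 p with hmu_def
  have hlam (i) : 0 ≤ lam i := cconv_nonneg hx1 hp i
  have hmu (i) : 0 ≤ mu i := cconv_nonneg hx2 hp i
  let s (i) := (lam i - min (lam i) (mu i)) / lam i
  let t (i) := (mu i - min (lam i) (mu i)) / mu i
  have hs (i) : 0 ≤ s i := div_nonneg (sub_nonneg.2 (min_le_left _ _)) (hlam i)
  have ht (i) : 0 ≤ t i := div_nonneg (sub_nonneg.2 (min_le_right _ _)) (hmu i)
  have hst (i) : s i + t i ≤ 1 := excess_div_add_excess_div_le_one (hlam i) (hmu i)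
  have hsl (i) : s i * lam i = lam i - min (lam i) (mu i) := excess_div_mul_self (hlam i) (hmu i)
  have htm (i) : t i * mu i = mu i - min (lam i) (mu i) := by
    simpa only [t, min_comm] using excess_div_mul_self (hmu i) (hlam i)
  let A (k : Fin K) (i : Fin (N + K - 1)) : ℝ := s i * delayed x1 k i / P
  let B (k : Fin K) (i : Fin (N + K - 1)) : ℝ := t i * delayed x2 k i / P
  have hA (k i) : 0 ≤ A k i := div_nonneg (mul_nonneg (hs i) (delayed_nonneg hx1 _ _)) hP
  have hB (k i) : 0 ≤ B k i := div_nonneg (mul_nonneg (ht i) (delayed_nonneg hx2 _ _)) hP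
  have hA_col (i) : ∑ k, A k i ≤ s i := by
    simp only [A, ← Finset.sum_div, ← Finset.mul_sum]
    rw [div_le_iff₀ hPpos]
    exact mul_le_mul_of_nonneg_left
      ((sum_delayed_le hx1 fun m a b ha hb => Fin.ext (by omega)).trans hs1) (hs i)
  have hB_col (i) : ∑ k, B k i ≤ t i := by
    simp only [B, ← Finset.sum_div, ← Finset.mul_sum]
    rw [div_le_iff₀ hPpos]
    exact mul_le_mul_of_nonneg_left
      ((sum_delayed_le hx2 fun m a b ha hb => Fin.ext (by omega)).trans hs2) (ht i)
  have hA_row (k) : ∑ i, A k i ≤ 1 := by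
    simp only [A, ← Finset.sum_div]
    rw [div_le_one hPpos]
    refine (Finset.sum_le_sum fun i _ => mul_le_of_le_one_left (delayed_nonneg hx1 _ _)
      (by linarith [ht i, hst i])).trans ((sum_delayed_le hx1 fun m a b ha hb => ?_).trans hs1)
    exact Fin.ext (by omega)
  have hB_row (k) : ∑ i, B k i ≤ 1 := by
    simp only [B, ← Finset.sum_div]
    rw [div_le_one hPpos]
    refine (Finset.sum_le_sum fun i _ => mul_le_of_le_one_left (delayed_nonneg hx2 _ _)
      (by linarith [hs i, hst i])).trans ((sum_delayed_le hx2 fun m a b ha hb => ?_).trans hs2)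
    exact Fin.ext (by omega)
  have hA_mean (i) : ∑ k, A k i * (P * p k) = lam i - min (lam i) (mu i) := by
    rw [← hsl, hlam_def, cconv_apply, Finset.mul_sum]
    refine Finset.sum_congr rfl fun k _ => ?_
    simp only [A]
    field_simp
  have hB_mean (i) : ∑ k, B k i * (P * p k) = mu i - min (lam i) (mu i) := by
    rw [← htm, hmu_def, cconv_apply, Finset.mul_sum]
    refine Finset.sum_congr rfl fun k _ => ?_
    simp only [B]
    field_simp
  let e : Fin K ⊕ Fin K → Fin (N + K - 1) :=
    Sum.elim (fun k => ⟨k, by omega⟩) (fun k => ⟨K + k, by omega⟩)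
  have he : e.Injective := by
    rintro (a | a) (b | b) h <;> simp only [e, Sum.elim_inl, Sum.elim_inr, Fin.mk.injEq] at h
    · rw [Fin.ext h]
    · omega
    · omega
    · rw [Fin.ext (Nat.add_left_cancel h)]
  have h1l (k) : cconv x1s p (e (.inl k)) = P * p k := by
    rw [cconv_pulse (by omega) hx1s]
    simp [e, Fin.val_inj]
  have h1r (k) : cconv x1s p (e (.inr k)) = 0 := by
    rw [cconv_pulse (by omega) hx1s]
    exact Finset.sum_eq_zero fun l _ => if_neg (by simp [e]; omega)
  have h2l (k) : cconv x2s p (e (.inl k)) = 0 := by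
    rw [cconv_pulse (by omega) hx2s]
    exact Finset.sum_eq_zero fun l _ => if_neg (by simp [e]; omega)
  have h2r (k) : cconv x2s p (e (.inr k)) = P * p k := by
    rw [cconv_pulse (by omega) hx2s]
    simp [e, Fin.val_inj]
  refine Pe_le_Pe_of_thinning_of_injective
    (fun i => add_nonneg (cconv_nonneg hx1s' hp i) hd.le)
    (fun i => add_nonneg (cconv_nonneg hx2s' hp i) hd.le) he (C := Sum.elim A B)
    (c := fun i => d * (1 - ∑ k, A k i - ∑ k, B k i) + min (lam i) (mu i))
    ?_ (fun i => ?_) ?_ (fun i => ?_) (fun i => ?_)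
  · rintro (k | k) i
    exacts [hA k i, hB k i]
  · have : 0 ≤ 1 - ∑ k, A k i - ∑ k, B k i := by linarith [hA_col i, hB_col i, hst i]
    exact add_nonneg (mul_nonneg hd.le this) (le_min (hlam i) (hmu i))
  · rintro (k | k)
    exacts [hA_row k, hB_row k]
  · simp only [Fintype.sum_sum_type, Sum.elim_inl, Sum.elim_inr, h1l, h1r, mul_add,
      Finset.sum_add_distrib, hA_mean, mul_zero, ← Finset.sum_mul]
    simp
    ring
  · simp only [Fintype.sum_sum_type, Sum.elim_inl, Sum.elim_inr, h2l, h2r, mul_add,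
      Finset.sum_add_distrib, hB_mean, mul_zero, ← Finset.sum_mul]
    simp
    ring
end

section
/- Consider a memoryless discrete Poisson channel (memory order K = 1) with coefficient π_0 ≥ 0 and dark noise d > 0, let N ≥ 2 and P ≥ 0. Define codewords x1*, x2* ∈ [0,∞)^N by x1* = (P, 0, …, 0) and x2* = (0, P, 0, …, 0). Then for every pair of codewords x1, x2 ∈ [0,∞)^N with ∑_{i=0}^{N−1} x1_i ≤ P and ∑_{i=0}^{N−1} x2_i ≤ P, one has P_e(π_0·x1*, π_0·x2*) ≤ P_e(π_0·x1, π_0·x2); that is, (x1*, x2*) minimizes the maximum-likelihood error probability among all codeword pairs satisfying the total-power constraint P. -/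
open scoped BigOperators

open scoped ENNReal

lemma poissonPdf_nonneg {a : ℝ} (ha : 0 ≤ a) (k : ℕ) : 0 ≤ poissonPdf a k := by
  unfold poissonPdf; positivity

lemma prodPdf_nonneg {n : ℕ} {m : Fin n → ℝ} (hm : ∀ i, 0 ≤ m i) (y : Fin n → ℕ) :
    0 ≤ prodPdf m y :=
  Finset.prod_nonneg fun i _ => poissonPdf_nonneg (hm i) _

/-- Poisson probability mass as an extended nonnegative real. -/
noncomputable def poissonMass (a : ℝ) (k : ℕ) : ℝ≥0∞ := ENNReal.ofReal (poissonPdf a k)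

/-- Expectation of `φ` under the law of independent Poisson coordinates with means `m`. -/
noncomputable def poissonExpect {n : ℕ} (m : Fin n → ℝ) (φ : (Fin n → ℕ) → ℝ≥0∞) : ℝ≥0∞ :=
  ∑' y, ENNReal.ofReal (prodPdf m y) * φ y

lemma ENNReal.tsum_mul_tsum_mul_comm {α β : Type*} (p : α → ℝ≥0∞) (q : β → ℝ≥0∞)
    (f : α → β → ℝ≥0∞) :
    ∑' x, p x * ∑' y, q y * f x y = ∑' y, q y * ∑' x, p x * f x y := by
  simp_rw [← ENNReal.tsum_mul_left]
  rw [ENNReal.tsum_comm]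
  simp_rw [mul_left_comm]

lemma poissonMass_tsum {a : ℝ} (ha : 0 ≤ a) : ∑' k, poissonMass a k = 1 := by
  have h := ProbabilityTheory.hasSum_one_poissonMeasure ⟨a, ha⟩
  have h' : HasSum (fun k => poissonPdf a k) 1 := h
  unfold poissonMass
  rw [← ENNReal.ofReal_tsum_of_nonneg (poissonPdf_nonneg ha) h'.summable, h'.tsum_eq,
    ENNReal.ofReal_one]

lemma poissonExpect_succ {n : ℕ} {m : Fin (n + 1) → ℝ} (hm : ∀ i, 0 ≤ m i)
    (φ : (Fin (n + 1) → ℕ) → ℝ≥0∞) :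
    poissonExpect m φ = ∑' k, poissonMass (m 0) k *
      poissonExpect (fun i => m i.succ) (fun y => φ (Fin.cons k y)) := by
  unfold poissonExpect
  rw [← (Fin.consEquiv fun _ : Fin (n + 1) => ℕ).tsum_eq, ENNReal.tsum_prod']
  refine tsum_congr fun k => ?_
  rw [← ENNReal.tsum_mul_left]
  refine tsum_congr fun y => ?_
  have h : prodPdf m (Fin.cons k y : Fin (n + 1) → ℕ) =
      poissonPdf (m 0) k * prodPdf (fun i => m i.succ) y := by
    simp [prodPdf, Fin.prod_univ_succ]
  have h2 : (Fin.consEquiv fun _ : Fin (n + 1) => ℕ) (k, y) = Fin.cons k y := rfl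
  rw [h2, h, ENNReal.ofReal_mul (poissonPdf_nonneg (hm 0) k), mul_assoc, poissonMass]

lemma poissonExpect_const {n : ℕ} {m : Fin n → ℝ} (hm : ∀ i, 0 ≤ m i) (c : ℝ≥0∞) :
    poissonExpect m (fun _ => c) = c := by
  induction n with
  | zero => simp [poissonExpect, prodPdf]
  | succ n ih =>
    rw [poissonExpect_succ hm]
    simp_rw [ih fun i => hm i.succ]
    rw [ENNReal.tsum_mul_right, poissonMass_tsum (hm 0), one_mul]

lemma poissonExpect_add_fun {n : ℕ} (m : Fin n → ℝ) (φ ψ : (Fin n → ℕ) → ℝ≥0∞) :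
    poissonExpect m (fun y => φ y + ψ y) = poissonExpect m φ + poissonExpect m ψ := by
  simp only [poissonExpect, mul_add, ENNReal.tsum_add]

lemma poissonPdf_add (a b : ℝ) (k : ℕ) :
    poissonPdf (a + b) k =
      ∑ p ∈ Finset.HasAntidiagonal.antidiagonal k, poissonPdf a p.1 * poissonPdf b p.2 := by
  unfold poissonPdf
  rw [add_comm a b, add_comm b a, Commute.add_pow' (Commute.all a b), neg_add, Real.exp_add,
    Finset.mul_sum, Finset.sum_div]
  refine Finset.sum_congr rfl fun p hp => ?_
  have hk := Finset.HasAntidiagonal.mem_antidiagonal.1 hp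
  have hc : (k.choose p.1 : ℝ) * (p.1.factorial * p.2.factorial) = k.factorial := by
    rw [← hk, ← mul_assoc, Nat.choose_symm_add]
    exact_mod_cast Nat.add_choose_mul_factorial_mul_factorial p.1 p.2
  have h1 : (p.1.factorial : ℝ) ≠ 0 := by positivity
  have h2 : (p.2.factorial : ℝ) ≠ 0 := by positivity
  have h3 : (k.factorial : ℝ) ≠ 0 := by positivity
  rw [nsmul_eq_mul]
  field_simp
  linear_combination (a ^ p.1 * b ^ p.2) * hc

lemma poissonMass_tsum_add {a b : ℝ} (ha : 0 ≤ a) (hb : 0 ≤ b) (φ : ℕ → ℝ≥0∞) :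
    ∑' x, poissonMass a x * ∑' y, poissonMass b y * φ (x + y) =
      ∑' k, poissonMass (a + b) k * φ k := by
  simp_rw [← ENNReal.tsum_mul_left]
  rw [← ENNReal.tsum_prod, ← Finset.HasAntidiagonal.sigmaAntidiagonalEquivProd.tsum_eq,
    ENNReal.tsum_sigma']
  refine tsum_congr fun k => ?_
  rw [tsum_fintype, poissonMass, poissonPdf_add, ENNReal.ofReal_sum_of_nonneg fun p _ =>
    mul_nonneg (poissonPdf_nonneg ha _) (poissonPdf_nonneg hb _), Finset.sum_mul,
    ← Finset.sum_coe_sort (Finset.HasAntidiagonal.antidiagonal k)]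
  refine Finset.sum_congr rfl fun p _ => ?_
  have hk := Finset.HasAntidiagonal.mem_antidiagonal.1 p.2
  rw [ENNReal.ofReal_mul (poissonPdf_nonneg ha _), mul_assoc]
  simp only [Finset.HasAntidiagonal.sigmaAntidiagonalEquivProd_apply]
  rw [hk]
  rfl

lemma poissonExpect_add {n : ℕ} {m l : Fin n → ℝ} (hm : ∀ i, 0 ≤ m i) (hl : ∀ i, 0 ≤ l i)
    (φ : (Fin n → ℕ) → ℝ≥0∞) :
    poissonExpect m (fun y => poissonExpect l fun z => φ (y + z)) =
      poissonExpect (fun i => m i + l i) φ := by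
  induction n with
  | zero =>
    simp only [poissonExpect, prodPdf, Finset.univ_eq_empty, Finset.prod_empty,
      ENNReal.ofReal_one, one_mul, tsum_fintype, Finset.univ_unique, Finset.sum_singleton]
    congr 1
    exact Subsingleton.elim _ _
  | succ n ih =>
    rw [poissonExpect_succ hm, poissonExpect_succ fun i => add_nonneg (hm i) (hl i),
      ← poissonMass_tsum_add (hm 0) (hl 0)]
    refine tsum_congr fun x => ?_
    congr 1
    simp_rw [poissonExpect_succ hl]
    rw [poissonExpect, ENNReal.tsum_mul_tsum_mul_comm]
    refine tsum_congr fun y => ?_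
    congr 1
    rw [← ih (fun i => hm i.succ) fun i => hl i.succ]
    refine tsum_congr fun z => ?_
    congr 2
    funext w
    congr 1
    funext i
    refine Fin.cases ?_ (fun j => ?_) i <;> simp

/-- Multinomial splitting: a Poisson count whose points are independently assigned to the
coordinates with probabilities `t` yields independent Poisson coordinates. -/
lemma exists_multinomial_kernel {n : ℕ} {t : Fin n → ℝ} (ht : ∀ i, 0 ≤ t i)
    (hsum : ∑ i, t i = 1) :
    ∃ K : ℕ → (Fin n → ℕ) → ℝ≥0∞, (∀ k, ∑' u, K k u = 1) ∧
      ∀ a, 0 ≤ a → ∀ φ : (Fin n → ℕ) → ℝ≥0∞,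
        ∑' k, poissonMass a k * ∑' u, K k u * φ u = poissonExpect (fun i => t i * a) φ := by
  classical
  let M : (Fin n → ℕ) → ℝ := fun u => Nat.multinomial Finset.univ u * ∏ i, t i ^ u i
  have hM : ∀ u, 0 ≤ M u := fun u =>
    mul_nonneg (Nat.cast_nonneg _) (Finset.prod_nonneg fun i _ => pow_nonneg (ht i) _)
  refine ⟨fun k u => if ∑ i, u i = k then ENNReal.ofReal (M u) else 0, fun k => ?_,
    fun a ha φ => ?_⟩
  · rw [tsum_eq_sum (s := Finset.piAntidiag Finset.univ k)]
    · rw [Finset.sum_congr rfl fun u hu => if_pos (Finset.mem_piAntidiag.1 hu).1,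
        ← ENNReal.ofReal_sum_of_nonneg fun u _ => hM u, ← Finset.sum_pow_eq_sum_piAntidiag,
        hsum, one_pow, ENNReal.ofReal_one]
    · intro u hu
      refine if_neg fun h => hu ?_
      simp [h]
  · rw [poissonExpect]
    simp_rw [← ENNReal.tsum_mul_left]
    rw [ENNReal.tsum_comm]
    refine tsum_congr fun u => ?_
    rw [tsum_eq_single (∑ i, u i) fun k hk => by simp [hk.symm]]
    rw [if_pos rfl, ← mul_assoc, poissonMass, ← ENNReal.ofReal_mul (poissonPdf_nonneg ha _)]
    congr 2
    have hf : ((∑ i, u i).factorial : ℝ) =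
        (∏ i, ((u i).factorial : ℝ)) * Nat.multinomial Finset.univ u := by
      exact_mod_cast (Nat.multinomial_spec Finset.univ u).symm
    have h0 : (∏ i, ((u i).factorial : ℝ)) ≠ 0 :=
      Finset.prod_ne_zero_iff.2 fun i _ => by positivity
    have h1 : (Nat.multinomial Finset.univ u : ℝ) ≠ 0 := by
      intro h
      rw [h, mul_zero] at hf
      exact (Nat.factorial_ne_zero _) (by exact_mod_cast hf)
    simp only [M, prodPdf, poissonPdf]
    rw [Finset.prod_div_distrib, Finset.prod_mul_distrib, ← Real.exp_sum]
    simp_rw [mul_pow]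
    rw [Finset.prod_mul_distrib, Finset.prod_pow_eq_pow_sum, Finset.sum_neg_distrib,
      ← Finset.sum_mul, hsum, one_mul, hf]
    field_simp

/-- Thinning: the points of a Poisson count are independently assigned to the coordinates
with probabilities `t`, or discarded. -/
lemma exists_thinning_kernel {n : ℕ} {t : Fin n → ℝ} (ht : ∀ i, 0 ≤ t i)
    (hsum : ∑ i, t i ≤ 1) :
    ∃ K : ℕ → (Fin n → ℕ) → ℝ≥0∞, (∀ k, ∑' u, K k u = 1) ∧
      ∀ a, 0 ≤ a → ∀ φ : (Fin n → ℕ) → ℝ≥0∞,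
        ∑' k, poissonMass a k * ∑' u, K k u * φ u = poissonExpect (fun i => t i * a) φ := by
  have ht' : ∀ i, 0 ≤ (Fin.cons (1 - ∑ i, t i) t : Fin (n + 1) → ℝ) i := by
    refine Fin.cases ?_ fun j => ?_
    · simpa using hsum
    · simpa using ht j
  obtain ⟨K, hK, hKa⟩ := exists_multinomial_kernel ht' (by simp [Fin.sum_univ_succ])
  have key : ∀ k (φ : (Fin n → ℕ) → ℝ≥0∞), ∑' u, (∑' j, K k (Fin.cons j u)) * φ u =
      ∑' v, K k v * φ (Fin.tail v) := by
    intro k φ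
    rw [← (Fin.consEquiv fun _ : Fin (n + 1) => ℕ).tsum_eq, ENNReal.tsum_prod',
      ENNReal.tsum_comm]
    refine tsum_congr fun u => ?_
    rw [← ENNReal.tsum_mul_right]
    rfl
  refine ⟨fun k u => ∑' j, K k (Fin.cons j u), fun k => ?_, fun a ha φ => ?_⟩
  · simpa [hK] using key k fun _ => 1
  · simp_rw [key]
    rw [hKa a ha, poissonExpect_succ fun i => mul_nonneg (ht' i) ha]
    simp only [Fin.cons_zero, Fin.cons_succ, Fin.tail_cons]
    rw [ENNReal.tsum_mul_right, poissonMass_tsum (mul_nonneg (by simpa using hsum) ha), one_mul]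

/-- A channel from pairs of counts to count vectors mapping independent Poisson inputs with
means `a`, `b` to independent Poisson outputs with means `t i * a + s i * b + c i`. -/
lemma exists_poisson_channel {n : ℕ} {t s c : Fin n → ℝ} (ht : ∀ i, 0 ≤ t i)
    (hs : ∀ i, 0 ≤ s i) (hc : ∀ i, 0 ≤ c i) (ht1 : ∑ i, t i ≤ 1) (hs1 : ∑ i, s i ≤ 1) :
    ∃ T : ((Fin n → ℕ) → ℝ≥0∞) → ℕ → ℕ → ℝ≥0∞,
      (∀ φ ψ, (∀ z, φ z + ψ z = 1) → ∀ x y, T φ x y + T ψ x y = 1) ∧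
      ∀ a b, 0 ≤ a → 0 ≤ b → ∀ φ,
        ∑' x, poissonMass a x * ∑' y, poissonMass b y * T φ x y =
          poissonExpect (fun i => t i * a + (s i * b + c i)) φ := by
  obtain ⟨K, hK, hKa⟩ := exists_thinning_kernel ht ht1
  obtain ⟨L, hL, hLb⟩ := exists_thinning_kernel hs hs1
  refine ⟨fun φ x y => ∑' u, K x u * ∑' v, L y v * poissonExpect c fun w => φ (u + (v + w)),
    fun φ ψ h x y => ?_, fun a b ha hb φ => ?_⟩
  · rw [← ENNReal.tsum_add]
    simp_rw [← mul_add, ← ENNReal.tsum_add, ← mul_add, ← poissonExpect_add_fun, h,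
      poissonExpect_const hc, mul_one, hL, mul_one, hK]
  · simp_rw [ENNReal.tsum_mul_tsum_mul_comm (poissonMass b)]
    rw [hKa a ha, ← poissonExpect_add (fun i => mul_nonneg (ht i) ha)
      fun i => add_nonneg (mul_nonneg (hs i) hb) (hc i)]
    congr 1
    funext u
    rw [hLb b hb, ← poissonExpect_add (fun i => mul_nonneg (hs i) hb) hc]

lemma errProb_eq {n : ℕ} {d : ℝ} {l m : Fin n → ℝ} (hl : ∀ i, 0 ≤ l i + d)
    (hm : ∀ i, 0 ≤ m i + d) (g : (Fin n → ℕ) → Bool) :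
    errProb d l m g = 1 / 2 *
      (poissonExpect (fun i => l i + d) (fun y => if g y = false then 1 else 0) +
        poissonExpect (fun i => m i + d) (fun y => if g y = true then 1 else 0)).toReal := by
  have key : ∀ (r : Fin n → ℝ), (∀ i, 0 ≤ r i) → ∀ b : Bool,
      poissonExpect r (fun y => if g y = b then 1 else 0) ≠ ⊤ ∧
      (∑' y, if g y = b then prodPdf r y else 0) =
        (poissonExpect r (fun y => if g y = b then 1 else 0)).toReal := by
    intro r hr b
    constructor
    · refine ne_top_of_le_ne_top ENNReal.one_ne_top
        (le_trans (ENNReal.tsum_le_tsum fun y => ?_) (poissonExpect_const hr 1).le)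
      gcongr
      dsimp only
      split_ifs <;> simp
    · rw [poissonExpect, ENNReal.tsum_toReal_eq]
      · refine tsum_congr fun y => ?_
        split_ifs <;> simp [prodPdf_nonneg hr y]
      · intro y
        split_ifs <;> simp
  obtain ⟨h1, h1'⟩ := key _ hl false
  obtain ⟨h2, h2'⟩ := key _ hm true
  rw [errProb, h1', h2', ENNReal.toReal_add h1 h2, mul_add]

lemma poissonExpect_first_two {n : ℕ} {m : Fin (n + 2) → ℝ} (hm : ∀ i, 0 ≤ m i)
    (f : ℕ → ℕ → ℝ≥0∞) :
    poissonExpect m (fun y => f (y 0) (y 1)) =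
      ∑' x, poissonMass (m 0) x * ∑' y, poissonMass (m 1) y * f x y := by
  rw [poissonExpect_succ hm]
  refine tsum_congr fun x => ?_
  rw [poissonExpect_succ fun i => hm i.succ]
  congr 1
  refine tsum_congr fun y => ?_
  have h : ∀ z : Fin n → ℕ, (Fin.cons x (Fin.cons y z : Fin (n + 1) → ℕ) : Fin (n + 2) → ℕ) 1
    = y := fun z => rfl
  simp only [Fin.cons_zero, h]
  rw [poissonExpect_const fun i => hm i.succ.succ]
  rfl

/-- Pulling points out of two single-pulse codewords simulates any other pair of codewords. -/
lemma exists_decoder_errProb_le {n : ℕ} {d Q : ℝ} (hd : 0 < d) (hQ : 0 ≤ Q)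
    {u v : Fin (n + 2) → ℝ} (hu : ∀ i, u i = if (i : ℕ) = 0 then Q else 0)
    (hv : ∀ i, v i = if (i : ℕ) = 1 then Q else 0)
    {l m : Fin (n + 2) → ℝ} (hl : ∀ i, 0 ≤ l i) (hm : ∀ i, 0 ≤ m i)
    (hlQ : ∑ i, l i ≤ Q) (hmQ : ∑ i, m i ≤ Q) (g : (Fin (n + 2) → ℕ) → Bool) :
    ∃ g' : (Fin (n + 2) → ℕ) → Bool, errProb d u v g' ≤ errProb d l m g := by
  classical
  have hsub : ∀ a b : Fin (n + 2) → ℝ, (∀ i, 0 ≤ a i) → (∀ i, 0 ≤ b i) → ∑ i, a i ≤ Q →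
      (∀ i, 0 ≤ (a i - min (a i) (b i)) / Q) ∧ ∑ i, (a i - min (a i) (b i)) / Q ≤ 1 ∧
      ∀ i, (a i - min (a i) (b i)) / Q * Q = a i - min (a i) (b i) := by
    intro a b ha hb haQ
    have haQ' : ∀ i, a i ≤ Q := fun i =>
      (Finset.single_le_sum (fun j _ => ha j) (Finset.mem_univ i)).trans haQ
    refine ⟨fun i => div_nonneg (sub_nonneg.2 (min_le_left _ _)) hQ, ?_, fun i => ?_⟩
    · rw [← Finset.sum_div]
      refine div_le_one_of_le₀ (le_trans (Finset.sum_le_sum fun i _ => ?_) haQ) hQ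
      linarith [le_min (ha i) (hb i)]
    · rcases hQ.eq_or_lt with h | h
      · have h0 : a i = 0 := le_antisymm (by linarith [haQ' i]) (ha i)
        simp [← h, h0, hb i]
      · exact div_mul_cancel₀ _ h.ne'
  obtain ⟨ht, ht1, htQ⟩ := hsub l m hl hm hlQ
  obtain ⟨hs, hs1, hsQ⟩ := hsub m l hm hl hmQ
  set t := fun i => (l i - min (l i) (m i)) / Q with ht_def
  set s := fun i => (m i - min (m i) (l i)) / Q with hs_def
  have hts : ∀ i, t i + s i ≤ 1 := by
    intro i
    have h1 := (Finset.single_le_sum (fun j _ => ht j) (Finset.mem_univ i)).trans ht1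
    have h2 := (Finset.single_le_sum (fun j _ => hs j) (Finset.mem_univ i)).trans hs1
    rcases le_total (l i) (m i) with h | h
    · have : t i = 0 := by simp [ht_def, h]
      rw [this, zero_add]; exact h2
    · have : s i = 0 := by simp [hs_def, h]
      rw [this, add_zero]; exact h1
  obtain ⟨T, hT, hTe⟩ := exists_poisson_channel (t := t) (s := s)
    (c := fun i => d * (1 - t i - s i) + min (l i) (m i)) ht hs
    (fun i => add_nonneg (mul_nonneg hd.le (by linarith [hts i])) (le_min (hl i) (hm i))) ht1 hs1
  let φ : (Fin (n + 2) → ℕ) → ℝ≥0∞ := fun y => if g y = false then 1 else 0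
  let ψ : (Fin (n + 2) → ℕ) → ℝ≥0∞ := fun y => if g y = true then 1 else 0
  have hφψ : ∀ z, φ z + ψ z = 1 := by
    intro z
    cases hz : g z <;> simp [φ, ψ, hz]
  let p : ℕ → ℕ → ℝ≥0∞ := fun x y => poissonMass (Q + d) x * poissonMass d y
  let q : ℕ → ℕ → ℝ≥0∞ := fun x y => poissonMass d x * poissonMass (Q + d) y
  refine ⟨fun y => decide (q (y 0) (y 1) ≤ p (y 0) (y 1)), ?_⟩
  have hu0 : ∀ i, 0 ≤ u i + d := fun i => by rw [hu]; split_ifs <;> linarith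
  have hv0 : ∀ i, 0 ≤ v i + d := fun i => by rw [hv]; split_ifs <;> linarith
  have hl0 : ∀ i, 0 ≤ l i + d := fun i => by linarith [hl i]
  have hm0 : ∀ i, 0 ≤ m i + d := fun i => by linarith [hm i]
  have e1 : poissonExpect (fun i => l i + d) φ = ∑' x, ∑' y, p x y * T φ x y := by
    simp_rw [p, mul_assoc, ENNReal.tsum_mul_left]
    rw [hTe (Q + d) d (by linarith) hd.le]
    congr 1
    funext i
    linarith [htQ i]
  have e2 : poissonExpect (fun i => m i + d) ψ = ∑' x, ∑' y, q x y * T ψ x y := by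
    simp_rw [q, mul_assoc, ENNReal.tsum_mul_left]
    rw [hTe d (Q + d) hd.le (by linarith)]
    congr 1
    funext i
    linarith [hsQ i, min_comm (l i) (m i)]
  have e3 : poissonExpect (fun i => u i + d)
      (fun y => if decide (q (y 0) (y 1) ≤ p (y 0) (y 1)) = false then 1 else 0) =
      ∑' x, ∑' y, p x y * if q x y ≤ p x y then 0 else 1 := by
    rw [poissonExpect_first_two hu0
      (fun x y => if decide (q x y ≤ p x y) = false then 1 else 0)]
    simp only [decide_eq_false_iff_not, ite_not, p, mul_assoc, ENNReal.tsum_mul_left, hu]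
    simp
  have e4 : poissonExpect (fun i => v i + d)
      (fun y => if decide (q (y 0) (y 1) ≤ p (y 0) (y 1)) = true then 1 else 0) =
      ∑' x, ∑' y, q x y * if q x y ≤ p x y then 1 else 0 := by
    rw [poissonExpect_first_two hv0
      (fun x y => if decide (q x y ≤ p x y) = true then 1 else 0)]
    simp only [decide_eq_true_eq, q, mul_assoc, ENNReal.tsum_mul_left, hv]
    simp
  rw [errProb_eq hu0 hv0, errProb_eq hl0 hm0]
  have hfin : poissonExpect (fun i => l i + d) φ + poissonExpect (fun i => m i + d) ψ ≠ ⊤ := by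
    have hle : poissonExpect (fun i => l i + d) φ + poissonExpect (fun i => m i + d) ψ ≤ 1 + 1 := by
      refine add_le_add ?_ ?_
      · refine le_trans (ENNReal.tsum_le_tsum fun y => ?_) (poissonExpect_const hl0 1).le
        gcongr
        exact hφψ y ▸ le_self_add
      · refine le_trans (ENNReal.tsum_le_tsum fun y => ?_) (poissonExpect_const hm0 1).le
        gcongr
        exact hφψ y ▸ le_add_self
    exact ne_top_of_le_ne_top (by simp) hle
  refine mul_le_mul_of_nonneg_left (ENNReal.toReal_mono hfin ?_) (by norm_num)
  rw [e1, e2, e3, e4]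
  simp_rw [← ENNReal.tsum_add]
  refine ENNReal.tsum_le_tsum fun x => ENNReal.tsum_le_tsum fun y => ?_
  have h1 := hT φ ψ hφψ x y
  split_ifs with h
  · calc p x y * 0 + q x y * 1 = q x y * (T φ x y + T ψ x y) := by simp [h1]
      _ = q x y * T φ x y + q x y * T ψ x y := mul_add _ _ _
      _ ≤ _ := by gcongr
  · calc p x y * 1 + q x y * 0 = p x y * (T φ x y + T ψ x y) := by simp [h1]
      _ = p x y * T φ x y + p x y * T ψ x y := mul_add _ _ _
      _ ≤ _ := by gcongr; exact (not_le.1 h).le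

/-- Memoryless Poisson channel (`K = 1`, coefficient `p0`): under a total-power
constraint `P` and blocklength `N ≥ 2`, the pair `x1* = (P,0,…,0)`, `x2* = (0,P,0,…,0)`
minimizes the ML error probability. -/
theorem stmt1 (p0 : ℝ) (hp0 : 0 ≤ p0) (d : ℝ) (hd : 0 < d) (N : ℕ) (hN : 2 ≤ N)
    (P : ℝ) (hP : 0 ≤ P)
    (x1s x2s : Fin N → ℝ)
    (hx1s : ∀ i : Fin N, x1s i = if (i : ℕ) = 0 then P else 0)
    (hx2s : ∀ i : Fin N, x2s i = if (i : ℕ) = 1 then P else 0) :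
    ∀ x1 x2 : Fin N → ℝ, (∀ i, 0 ≤ x1 i) → (∀ i, 0 ≤ x2 i) →
      (∑ i, x1 i) ≤ P → (∑ i, x2 i) ≤ P →
      Pe d (fun i => p0 * x1s i) (fun i => p0 * x2s i)
        ≤ Pe d (fun i => p0 * x1 i) (fun i => p0 * x2 i) := by
  intro x1 x2 h1 h2 h1P h2P
  obtain ⟨n, rfl⟩ : ∃ n, N = n + 2 := ⟨N - 2, by omega⟩
  refine le_ciInf fun g => ?_
  obtain ⟨g', hg'⟩ := exists_decoder_errProb_le hd (mul_nonneg hp0 hP)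
    (u := fun i => p0 * x1s i) (v := fun i => p0 * x2s i)
    (fun i => by rw [hx1s, mul_ite, mul_zero]) (fun i => by rw [hx2s, mul_ite, mul_zero])
    (fun i => mul_nonneg hp0 (h1 i)) (fun i => mul_nonneg hp0 (h2 i))
    (by rw [← Finset.mul_sum]; exact mul_le_mul_of_nonneg_left h1P hp0)
    (by rw [← Finset.mul_sum]; exact mul_le_mul_of_nonneg_left h2P hp0) g
  refine (ciInf_le ⟨0, ?_⟩ g').trans hg'
  rintro _ ⟨f, rfl⟩
  have h1s : ∀ i, 0 ≤ p0 * x1s i + d := fun i => by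
    have : 0 ≤ x1s i := by rw [hx1s]; split_ifs <;> simp [hP]
    positivity
  have h2s : ∀ i, 0 ≤ p0 * x2s i + d := fun i => by
    have : 0 ≤ x2s i := by rw [hx2s]; split_ifs <;> simp [hP]
    positivity
  simp only [errProb_eq h1s h2s]
  positivity
end

section
/- Let K ≥ 1, N ≥ 1, π ∈ [0,∞)^K, P ≥ 0, and let x ∈ [0,∞)^N satisfy ∑_{i=0}^{N−1} x_i ≤ P. Then the vector λ = x * π ∈ [0,∞)^{N+K−1} is weakly submajorized by the vector v := (Pπ_0, Pπ_1, …, Pπ_{K−1}, 0, …, 0) ∈ [0,∞)^{N+K−1} (the vector Pπ padded with N−1 zeros): for every k ∈ {1, …, N+K−1}, the sum of the k largest entries of λ is at most the sum of the k largest entries of v. -/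
open scoped BigOperators

theorem sum_le_topSum {m : ℕ} {v : Fin m → ℝ} (s : Finset (Fin m)) :
    ∑ i ∈ s, v i ≤ topSum v s.card := by
  refine le_ciSup_of_le (Set.finite_range _).bddAbove s ?_
  rw [ciSup_pos (show s ∈ {t : Finset (Fin m) | t.card = s.card} from rfl)]

theorem topSum_le {m : ℕ} {v : Fin m → ℝ} {k : ℕ} {M : ℝ} (hM : 0 ≤ M)
    (h : ∀ s : Finset (Fin m), s.card = k → ∑ i ∈ s, v i ≤ M) : topSum v k ≤ M :=
  Real.iSup_le (fun s => Real.iSup_le (fun hs => h s hs) hM) hM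

theorem sum_le_topSum_of_card_le {m : ℕ} {v : Fin m → ℝ} (hv : ∀ i, 0 ≤ v i) {k : ℕ}
    (hk : k ≤ m) {s : Finset (Fin m)} (hs : s.card ≤ k) : ∑ i ∈ s, v i ≤ topSum v k := by
  obtain ⟨t, hst, rfl⟩ := Finset.exists_superset_card_eq hs (by simpa using hk)
  exact (Finset.sum_le_sum_of_subset_of_nonneg hst fun i _ _ => hv i).trans (sum_le_topSum t)

/-- The position in the output at which input position `n` meets channel tap `j`. -/
def convIndex {N K : ℕ} (n : Fin N) (j : Fin K) : Fin (N + K - 1) :=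
  ⟨n + j, by omega⟩

theorem convIndex_injective {N K : ℕ} (n : Fin N) :
    Function.Injective (convIndex n : Fin K → Fin (N + K - 1)) := by
  intro a b h
  simpa [convIndex, Fin.ext_iff] using h

theorem cconv_eq_sum {N K : ℕ} (x : Fin N → ℝ) (p : Fin K → ℝ) (i : Fin (N + K - 1)) :
    cconv x p i = ∑ n, x n * ∑ j, if convIndex n j = i then p j else 0 := by
  simp_rw [Finset.mul_sum]
  rw [Finset.sum_comm, cconv]
  refine Finset.sum_congr rfl fun j _ => ?_
  split_ifs with h
  · rw [Finset.sum_eq_single ⟨(i : ℕ) - j, h.2⟩, if_pos, mul_comm]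
    · simp only [convIndex, Fin.ext_iff]
      omega
    · intro n _ hn
      rw [if_neg, mul_zero]
      simp only [convIndex, Fin.ext_iff, ne_eq] at hn ⊢
      omega
    · simp
  · rw [mul_zero, Finset.sum_eq_zero]
    intro n _
    rw [if_neg, mul_zero]
    simp only [convIndex, Fin.ext_iff]
    omega

theorem sum_cconv_eq_sum {N K : ℕ} (x : Fin N → ℝ) (p : Fin K → ℝ)
    (s : Finset (Fin (N + K - 1))) :
    ∑ i ∈ s, cconv x p i = ∑ n, x n * ∑ j with convIndex n j ∈ s, p j := by
  simp_rw [cconv_eq_sum]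
  rw [Finset.sum_comm]
  refine Finset.sum_congr rfl fun n _ => ?_
  rw [← Finset.mul_sum, Finset.sum_comm, Finset.sum_filter]
  simp

/-- If `x` is a nonnegative codeword of total power at most `P`, then `x * π` is weakly
submajorized by the vector `(Pπ₀, …, Pπ_{K−1}, 0, …, 0)` of length `N + K − 1`. -/
theorem stmt5 (K N : ℕ) (hK : 1 ≤ K) (hN : 1 ≤ N)
    (p : Fin K → ℝ) (hp : ∀ j, 0 ≤ p j)
    (P : ℝ) (hP : 0 ≤ P)
    (x : Fin N → ℝ) (hx : ∀ i, 0 ≤ x i) (hsum : (∑ i, x i) ≤ P)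
    (v : Fin (N + K - 1) → ℝ)
    (hv : ∀ i : Fin (N + K - 1), v i = if h : (i : ℕ) < K then P * p ⟨(i : ℕ), h⟩ else 0) :
    ∀ k, 1 ≤ k → k ≤ N + K - 1 → topSum (cconv x p) k ≤ topSum v k := by
  intro k _ hk
  have hv0 : ∀ i, 0 ≤ v i := by
    intro i
    rw [hv]
    split_ifs
    · exact mul_nonneg hP (hp _)
    · exact le_rfl
  have hM : 0 ≤ topSum v k := by
    simpa using sum_le_topSum_of_card_le hv0 hk (s := ∅) (Nat.zero_le k)
  refine topSum_le hM fun s hs => ?_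
  rw [sum_cconv_eq_sum]
  rcases hP.eq_or_lt with rfl | hP
  · have hx0 : ∀ n, x n = 0 := fun n => le_antisymm
      ((Finset.single_le_sum (fun i _ => hx i) (Finset.mem_univ n)).trans hsum) (hx n)
    simpa [hx0] using hM
  have hbound (n : Fin N) : ∑ j with convIndex n j ∈ s, p j ≤ topSum v k / P := by
    rw [le_div_iff₀' hP, Finset.mul_sum]
    have hKm : K ≤ N + K - 1 := by omega
    have hcard : ({j | convIndex n j ∈ s} : Finset (Fin K)).card ≤ k :=
      hs ▸ Finset.card_le_card_of_injOn (convIndex n) (by simp [Set.MapsTo])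
        (convIndex_injective n).injOn
    have h := sum_le_topSum_of_card_le hv0 hk
      (s := ({j | convIndex n j ∈ s} : Finset (Fin K)).map (Fin.castLEEmb hKm))
      (by rwa [Finset.card_map])
    simpa [hv] using h
  calc ∑ n, x n * ∑ j with convIndex n j ∈ s, p j
      ≤ ∑ n, x n * (topSum v k / P) :=
        Finset.sum_le_sum fun n _ => mul_le_mul_of_nonneg_left (hbound n) (hx n)
    _ = (∑ n, x n) * (topSum v k / P) := by rw [Finset.sum_mul]
    _ ≤ P * (topSum v k / P) := mul_le_mul_of_nonneg_right hsum (div_nonneg hM hP.le)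
    _ = topSum v k := mul_div_cancel₀ _ hP.ne'
end
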